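/- Frobenius's determinant formula: for complex x₁,...,xₙ, y₁,...,yₙ and parameter t such that all theta values in denominators are nonzero, det_{1≤i,j≤n} [θ₁(xᵢ-yⱼ+t;τ)/(θ₁(xᵢ-yⱼ;τ)θ₁(t;τ))] = [θ₁(∑ⱼ(xⱼ-yⱼ)+t;τ)/θ₁(t;τ)] · [∏_{i<j} θ₁(xᵢ-xⱼ;τ)θ₁(yⱼ-yᵢ;τ)] / [∏_{i,j} θ₁(xᵢ-yⱼ;τ)]. -/

import Mathlib

open Complex Real BigOperators

/-- The Jacobi theta function `θ₁(z;τ)`. -/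
noncomputable def jacobiTheta₁ (z τ : ℂ) : ℂ :=
  -Complex.I * ∑' k : ℤ, (-1 : ℂ) ^ k *
    Complex.exp ((π : ℂ) * Complex.I * τ * ((k : ℂ) + 1 / 2) ^ 2) *
    Complex.exp (2 * (π : ℂ) * Complex.I * ((k : ℂ) + 1 / 2) * z)

/-- The derivative of `θ₁` with respect to `z`. -/
noncomputable def jacobiTheta₁' (z τ : ℂ) : ℂ :=
  deriv (fun w => jacobiTheta₁ w τ) z

/-- The general term of the theta series with characteristic `s`. -/
noncomputable def thetaCharTerm (s z τ : ℂ) (k : ℤ) : ℂ :=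
  Complex.exp ((π : ℂ) * Complex.I * τ * ((k : ℂ) + s) ^ 2 +
    2 * (π : ℂ) * Complex.I * ((k : ℂ) + s) * z)

/-- The theta series with characteristic `s`. -/
noncomputable def thetaChar (s z τ : ℂ) : ℂ := ∑' k : ℤ, thetaCharTerm s z τ k

lemma thetaCharTerm_eq (s z τ : ℂ) (k : ℤ) :
    thetaCharTerm s z τ k =
      Complex.exp ((π : ℂ) * Complex.I * τ * s ^ 2 + 2 * (π : ℂ) * Complex.I * s * z) *
        jacobiTheta₂_term k (z + s * τ) τ := by
  rw [thetaCharTerm, jacobiTheta₂_term, ← Complex.exp_add]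
  congr 1
  ring

lemma summable_thetaCharTerm (s z : ℂ) {τ : ℂ} (hτ : 0 < τ.im) :
    Summable (thetaCharTerm s z τ) := by
  simp_rw [funext (thetaCharTerm_eq s z τ)]
  exact ((summable_jacobiTheta₂_term_iff _ _).2 hτ).mul_left _

lemma jacobiTheta₁_eq_tsum (z τ : ℂ) :
    jacobiTheta₁ z τ = -Complex.I * ∑' k : ℤ, (-1 : ℂ) ^ k * thetaCharTerm (1 / 2) z τ k := by
  simp only [jacobiTheta₁, thetaCharTerm, Complex.exp_add, mul_assoc]

lemma summable_norm_neg_one_zpow_mul_thetaCharTerm (s z : ℂ) {τ : ℂ} (hτ : 0 < τ.im) :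
    Summable fun k : ℤ => ‖(-1 : ℂ) ^ k * thetaCharTerm s z τ k‖ := by
  simpa using (summable_thetaCharTerm s z hτ).norm

lemma neg_one_zpow_eq_exp (k : ℤ) : (-1 : ℂ) ^ k = Complex.exp (k * ((π : ℂ) * Complex.I)) := by
  rw [Complex.exp_int_mul, Complex.exp_pi_mul_I]

lemma jacobiTheta₁_eq_jacobiTheta₂ (z τ : ℂ) :
    jacobiTheta₁ z τ = -Complex.I * (Complex.exp ((π : ℂ) * Complex.I * τ / 4 +
      (π : ℂ) * Complex.I * z) * jacobiTheta₂ (z + τ / 2 + 1 / 2) τ) := by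
  rw [jacobiTheta₁_eq_tsum, jacobiTheta₂, ← tsum_mul_left (a := Complex.exp _)]
  congr 1
  refine tsum_congr fun k => ?_
  rw [neg_one_zpow_eq_exp, thetaCharTerm, jacobiTheta₂_term, ← Complex.exp_add, ← Complex.exp_add]
  congr 1
  ring

lemma differentiable_jacobiTheta₁ {τ : ℂ} (hτ : 0 < τ.im) :
    Differentiable ℂ fun z => jacobiTheta₁ z τ := by
  simp_rw [jacobiTheta₁_eq_jacobiTheta₂]
  have h : Differentiable ℂ fun z => jacobiTheta₂ z τ :=
    fun z => differentiableAt_jacobiTheta₂_fst z hτ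
  have h' : Differentiable ℂ fun z => jacobiTheta₂ (z + τ / 2 + 1 / 2) τ :=
    h.comp (g := fun z => jacobiTheta₂ z τ) (f := fun z => z + τ / 2 + 1 / 2) (by fun_prop)
  fun_prop

/-- Pairs of integers with even coordinate sum, parametrized by `(a + b, a - b)`, and those with
odd coordinate sum, parametrized by `(a + b, a - b - 1)`, partition `ℤ × ℤ`. -/
lemma isCompl_range_add_sub :
    IsCompl (Set.range fun p : ℤ × ℤ => (p.1 + p.2, p.1 - p.2))
      (Set.range fun p : ℤ × ℤ => (p.1 + p.2, p.1 - p.2 - 1)) := by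
  rw [isCompl_iff, Set.disjoint_left, codisjoint_iff_le_sup]
  constructor
  · rintro _ ⟨⟨a, b⟩, rfl⟩ ⟨⟨c, d⟩, h⟩
    simp only [Prod.mk.injEq] at h
    omega
  · rintro ⟨m, n⟩ -
    rcases Int.even_or_odd' (m + n) with ⟨c, h | h⟩
    · exact Or.inl ⟨(c, m - c), by simp only [Prod.mk.injEq]; omega⟩
    · exact Or.inr ⟨(c + 1, m - c - 1), by simp only [Prod.mk.injEq]; omega⟩

lemma tsum_int_prod_eq_add_of_parity {f : ℤ × ℤ → ℂ} (hf : Summable f) :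
    ∑' p, f p = ∑' p : ℤ × ℤ, f (p.1 + p.2, p.1 - p.2) +
      ∑' p : ℤ × ℤ, f (p.1 + p.2, p.1 - p.2 - 1) := by
  have h₁ : Function.Injective fun p : ℤ × ℤ => (p.1 + p.2, p.1 - p.2) := by
    rintro ⟨a, b⟩ ⟨c, d⟩ h
    simp only [Prod.mk.injEq] at h ⊢
    omega
  have h₂ : Function.Injective fun p : ℤ × ℤ => (p.1 + p.2, p.1 - p.2 - 1) := by
    rintro ⟨a, b⟩ ⟨c, d⟩ h
    simp only [Prod.mk.injEq] at h ⊢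
    omega
  refine HasSum.tsum_eq (HasSum.add_isCompl isCompl_range_add_sub ?_ ?_)
  · exact h₁.hasSum_range_iff.2 (hf.comp_injective h₁).hasSum
  · exact h₂.hasSum_range_iff.2 (hf.comp_injective h₂).hasSum

/-- The product `θ₁(u + v) θ₁(u - v)` is an alternating form in a pair of theta functions of
modulus `2τ`. -/
lemma jacobiTheta₁_add_mul_jacobiTheta₁_sub (u v : ℂ) {τ : ℂ} (hτ : 0 < τ.im) :
    jacobiTheta₁ (u + v) τ * jacobiTheta₁ (u - v) τ =
      thetaChar 0 (2 * u) (2 * τ) * thetaChar (1 / 2) (2 * v) (2 * τ) -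
        thetaChar (1 / 2) (2 * u) (2 * τ) * thetaChar 0 (2 * v) (2 * τ) := by
  have hτ2 : 0 < (2 * τ).im := by simpa using hτ
  have hn (s z : ℂ) := (summable_thetaCharTerm s z hτ2).norm
  have h₁ := summable_norm_neg_one_zpow_mul_thetaCharTerm (1 / 2) (u + v) hτ
  have h₂ := summable_norm_neg_one_zpow_mul_thetaCharTerm (1 / 2) (u - v) hτ
  have hI : ∀ X Y : ℂ, -Complex.I * X * (-Complex.I * Y) = -(X * Y) := fun X Y => by
    linear_combination X * Y * Complex.I_mul_I
  rw [jacobiTheta₁_eq_tsum, jacobiTheta₁_eq_tsum, hI, tsum_mul_tsum_of_summable_norm h₁ h₂,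
    tsum_int_prod_eq_add_of_parity (summable_mul_of_summable_norm h₁ h₂)]
  simp only [thetaChar]
  rw [tsum_mul_tsum_of_summable_norm (hn _ _) (hn _ _),
    tsum_mul_tsum_of_summable_norm (hn _ _) (hn _ _), neg_eq_iff_eq_neg, neg_sub]
  refine Eq.trans ?_ (sub_eq_add_neg _ _).symm
  rw [← tsum_neg]
  have hsq (a : ℤ) : ((-1 : ℂ) ^ a) * (-1) ^ a = 1 := by
    rw [← mul_zpow]; simp
  have hne : (-1 : ℂ) ≠ 0 := by norm_num
  congr 1 <;> refine tsum_congr fun ⟨a, b⟩ => ?_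
  · have hs : (-1 : ℂ) ^ (a + b) * (-1) ^ (a - b) = 1 := by
      rw [← zpow_add₀ hne, show a + b + (a - b) = a + a by ring, zpow_add₀ hne, hsq]
    rw [mul_mul_mul_comm, hs, one_mul]
    simp only [thetaCharTerm, ← Complex.exp_add]
    push_cast
    congr 1
    ring
  · have hs : (-1 : ℂ) ^ (a + b) * (-1) ^ (a - b - 1) = -1 := by
      rw [← zpow_add₀ hne, show a + b + (a - b - 1) = a + a - 1 by ring, zpow_sub₀ hne,
        zpow_add₀ hne, hsq]
      norm_num
    rw [mul_mul_mul_comm, hs, neg_one_mul]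
    simp only [thetaCharTerm, ← Complex.exp_add]
    push_cast
    congr 2
    ring

/-- The three-term (Weierstrass) identity for `θ₁`. -/
lemma jacobiTheta₁_three_term (p q r s t : ℂ) {τ : ℂ} (hτ : 0 < τ.im) :
    jacobiTheta₁ (q - s + t) τ * jacobiTheta₁ (p - r + t) τ *
        (jacobiTheta₁ (q - r) τ * jacobiTheta₁ (p - s) τ) -
      jacobiTheta₁ (q - r + t) τ * jacobiTheta₁ (p - s + t) τ *
        (jacobiTheta₁ (q - s) τ * jacobiTheta₁ (p - r) τ) =
      jacobiTheta₁ t τ * jacobiTheta₁ (q - s + (p - r + t)) τ *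
        (jacobiTheta₁ (p - q) τ * jacobiTheta₁ (s - r) τ) := by
  obtain ⟨a, ha⟩ : ∃ a, a = (p + q - r - s) / 2 + t := ⟨_, rfl⟩
  obtain ⟨b, hb⟩ : ∃ b, b = (p + q - r - s) / 2 := ⟨_, rfl⟩
  obtain ⟨c, hc⟩ : ∃ c, c = (p + s - q - r) / 2 := ⟨_, rfl⟩
  obtain ⟨d, hd⟩ : ∃ d, d = (p + r - q - s) / 2 := ⟨_, rfl⟩
  rw [show q - s + t = a - c by rw [ha, hc]; ring, show p - r + t = a + c by rw [ha, hc]; ring,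
    show q - r = b - d by rw [hb, hd]; ring, show p - s = b + d by rw [hb, hd]; ring,
    show b - d + t = a - d by rw [ha, hb]; ring, show b + d + t = a + d by rw [ha, hb]; ring,
    show q - s + (a + c) = a + b by rw [ha, hb, hc]; ring,
    show q - s = b - c by rw [hb, hc]; ring, show p - r = b + c by rw [hb, hc]; ring,
    show t = a - b by rw [ha, hb]; ring, show p - q = c + d by rw [hc, hd]; ring,
    show s - r = c - d by rw [hc, hd]; ring]
  have h (u v : ℂ) := jacobiTheta₁_add_mul_jacobiTheta₁_sub u v hτ
  rw [mul_comm (jacobiTheta₁ (a - c) τ), mul_comm (jacobiTheta₁ (b - d) τ),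
    mul_comm (jacobiTheta₁ (a - d) τ), mul_comm (jacobiTheta₁ (b - c) τ),
    mul_comm (jacobiTheta₁ (a - b) τ), h, h, h, h, h, h]
  ring

/-- Expansion of a determinant by its Schur complement with respect to the top left entry. -/
lemma det_succ_eq_mul_det_schur {K : Type*} [Field K] {n : ℕ}
    (M : Matrix (Fin (n + 1)) (Fin (n + 1)) K) (h : M 0 0 ≠ 0) :
    M.det = M 0 0 * Matrix.det (Matrix.of fun i j : Fin n =>
      M i.succ j.succ - M i.succ 0 / M 0 0 * M 0 j.succ) := by
  let c : Fin (n + 1) → K := Fin.cons 0 fun i => M i.succ 0 / M 0 0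
  let B : Matrix (Fin (n + 1)) (Fin (n + 1)) K := Matrix.of fun i j => M i j - c i * M 0 j
  have hMB : M.det = B.det :=
    Matrix.det_eq_of_forall_row_eq_smul_add_const c 0 rfl fun i j => by simp [B, c]
  rw [hMB, Matrix.det_succ_column_zero, Fin.sum_univ_succ, Finset.sum_eq_zero]
  · simp only [Fin.val_zero, pow_zero, one_mul, add_zero]
    congr 1
    simp [B, c]
  · intro i _
    simp [B, c, h]

lemma prod_filter_lt_succ {M : Type*} [CommMonoid M] {n : ℕ} (f : Fin (n + 1) → Fin (n + 1) → M) :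
    ∏ i, ∏ j ∈ Finset.univ.filter (fun j => i < j), f i j =
      (∏ j : Fin n, f 0 j.succ) *
        ∏ i : Fin n, ∏ j ∈ Finset.univ.filter (fun j => i < j), f i.succ j.succ := by
  simp [Finset.prod_filter, Fin.prod_univ_succ]

/-- Zeros of the entire function `z ↦ θ₁(z)` are isolated once it is not identically zero. -/
lemma eventually_jacobiTheta₁_add_ne_zero {t τ : ℂ} (hτ : 0 < τ.im) (ht : jacobiTheta₁ t τ ≠ 0)
    (a b : ℂ) : ∀ᶠ s in nhdsWithin a {a}ᶜ, jacobiTheta₁ (b + s) τ ≠ 0 := by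
  have hd : Differentiable ℂ fun s => jacobiTheta₁ (b + s) τ :=
    (differentiable_jacobiTheta₁ hτ).comp (g := fun z => jacobiTheta₁ z τ)
      (f := fun s => b + s) (by fun_prop)
  have ha : AnalyticOnNhd ℂ (fun s => jacobiTheta₁ (b + s) τ) Set.univ :=
    fun z _ => hd.analyticAt z
  by_contra hcon
  refine ht ?_
  have := ha.eqOn_zero_of_preconnected_of_frequently_eq_zero isPreconnected_univ
    (Set.mem_univ a) hcon (Set.mem_univ (t - b))
  simpa using this

/-- The inductive step of the determinant formula, under a genericity condition on `t`. -/
lemma frobenius_determinant_step {n : ℕ} {τ : ℂ} (hτ : 0 < τ.im)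
    (x y : Fin (n + 1) → ℂ) (t : ℂ) (ht : jacobiTheta₁ t τ ≠ 0)
    (ht' : jacobiTheta₁ (x 0 - y 0 + t) τ ≠ 0)
    (hxy : ∀ i j, jacobiTheta₁ (x i - y j) τ ≠ 0)
    (ih : Matrix.det (Matrix.of fun i j : Fin n =>
        jacobiTheta₁ (x i.succ - y j.succ + (x 0 - y 0 + t)) τ /
          (jacobiTheta₁ (x i.succ - y j.succ) τ * jacobiTheta₁ (x 0 - y 0 + t) τ))
      = jacobiTheta₁ (∑ j : Fin n, (x j.succ - y j.succ) + (x 0 - y 0 + t)) τ /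
          jacobiTheta₁ (x 0 - y 0 + t) τ *
          (∏ i : Fin n, ∏ j ∈ Finset.univ.filter (fun j => i < j),
            jacobiTheta₁ (x i.succ - x j.succ) τ * jacobiTheta₁ (y j.succ - y i.succ) τ) /
          ∏ i : Fin n, ∏ j : Fin n, jacobiTheta₁ (x i.succ - y j.succ) τ) :
    Matrix.det (Matrix.of fun i j : Fin (n + 1) =>
        jacobiTheta₁ (x i - y j + t) τ / (jacobiTheta₁ (x i - y j) τ * jacobiTheta₁ t τ))
      = jacobiTheta₁ (∑ j, (x j - y j) + t) τ / jacobiTheta₁ t τ *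
          (∏ i, ∏ j ∈ Finset.univ.filter (fun j => i < j),
            jacobiTheta₁ (x i - x j) τ * jacobiTheta₁ (y j - y i) τ) /
          ∏ i, ∏ j, jacobiTheta₁ (x i - y j) τ := by
  rw [det_succ_eq_mul_det_schur _ (by simp [ht, ht', hxy])]
  simp only [Matrix.of_apply]
  let u : Fin n → ℂ := fun i => jacobiTheta₁ (x 0 - x i.succ) τ / jacobiTheta₁ (x i.succ - y 0) τ
  let v : Fin n → ℂ := fun j => jacobiTheta₁ (y j.succ - y 0) τ / jacobiTheta₁ (x 0 - y j.succ) τ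
  let N : Matrix (Fin n) (Fin n) ℂ := Matrix.of fun i j =>
    jacobiTheta₁ (x i.succ - y j.succ + (x 0 - y 0 + t)) τ /
      (jacobiTheta₁ (x i.succ - y j.succ) τ * jacobiTheta₁ (x 0 - y 0 + t) τ)
  have hN : (Matrix.of fun i j : Fin n =>
      jacobiTheta₁ (x i.succ - y j.succ + t) τ /
          (jacobiTheta₁ (x i.succ - y j.succ) τ * jacobiTheta₁ t τ) -
        jacobiTheta₁ (x i.succ - y 0 + t) τ / (jacobiTheta₁ (x i.succ - y 0) τ * jacobiTheta₁ t τ) /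
          (jacobiTheta₁ (x 0 - y 0 + t) τ / (jacobiTheta₁ (x 0 - y 0) τ * jacobiTheta₁ t τ)) *
        (jacobiTheta₁ (x 0 - y j.succ + t) τ /
          (jacobiTheta₁ (x 0 - y j.succ) τ * jacobiTheta₁ t τ))) =
      Matrix.of fun i j => u i * (Matrix.of fun i j => v j * N i j) i j := by
    ext i j
    have key := jacobiTheta₁_three_term (x 0) (x i.succ) (y 0) (y j.succ) t hτ
    have h₁ := hxy i.succ j.succ
    have h₂ := hxy i.succ 0
    have h₃ := hxy 0 j.succ
    have h₄ := hxy 0 0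
    simp only [Matrix.of_apply, u, v, N]
    field_simp
    linear_combination key
  rw [hN, Matrix.det_mul_column, Matrix.det_mul_row, ih, prod_filter_lt_succ,
    Fin.prod_univ_succ (fun i => ∏ j, jacobiTheta₁ (x i - y j) τ), Fin.sum_univ_succ]
  simp only [Fin.prod_univ_succ (fun j => jacobiTheta₁ (x _ - y j) τ), Finset.prod_mul_distrib,
    u, v, Finset.prod_div_distrib]
  rw [show ∑ j : Fin n, (x j.succ - y j.succ) + (x 0 - y 0 + t) =
    x 0 - y 0 + ∑ j : Fin n, (x j.succ - y j.succ) + t by ring]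
  have h₁ : ∏ i : Fin n, ∏ j : Fin n, jacobiTheta₁ (x i.succ - y j.succ) τ ≠ 0 :=
    Finset.prod_ne_zero_iff.2 fun i _ => Finset.prod_ne_zero_iff.2 fun j _ => hxy _ _
  have h₂ : ∏ i : Fin n, jacobiTheta₁ (x i.succ - y 0) τ ≠ 0 :=
    Finset.prod_ne_zero_iff.2 fun i _ => hxy _ _
  have h₃ : ∏ j : Fin n, jacobiTheta₁ (x 0 - y j.succ) τ ≠ 0 :=
    Finset.prod_ne_zero_iff.2 fun i _ => hxy _ _
  have h₄ := hxy 0 0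
  field_simp

/-- Frobenius's determinant formula for elliptic Cauchy-type matrices. -/
theorem frobenius_determinant_formula (n : ℕ) (τ : ℂ) (hτ : 0 < τ.im)
    (x y : Fin n → ℂ) (t : ℂ)
    (ht : jacobiTheta₁ t τ ≠ 0)
    (hxy : ∀ i j, jacobiTheta₁ (x i - y j) τ ≠ 0) :
    Matrix.det (Matrix.of fun i j : Fin n =>
        jacobiTheta₁ (x i - y j + t) τ / (jacobiTheta₁ (x i - y j) τ * jacobiTheta₁ t τ))
      = jacobiTheta₁ (∑ j, (x j - y j) + t) τ / jacobiTheta₁ t τ *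
          (∏ i, ∏ j ∈ Finset.univ.filter (fun j => i < j),
            jacobiTheta₁ (x i - x j) τ * jacobiTheta₁ (y j - y i) τ) /
          ∏ i, ∏ j, jacobiTheta₁ (x i - y j) τ := by
  induction n generalizing t with
  | zero => simp [ht]
  | succ n ih =>
    have hc : Continuous fun z => jacobiTheta₁ z τ := (differentiable_jacobiTheta₁ hτ).continuous
    have hadd (b : ℂ) : ContinuousAt (fun s => jacobiTheta₁ (b + s) τ) t :=
      (hc.comp (continuous_const.add continuous_id)).continuousAt
    have hL : ContinuousAt (fun s => Matrix.det (Matrix.of fun i j : Fin (n + 1) =>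
        jacobiTheta₁ (x i - y j + s) τ / (jacobiTheta₁ (x i - y j) τ * jacobiTheta₁ s τ))) t := by
      simp only [Matrix.det_apply, Matrix.of_apply]
      refine tendsto_finsetSum _ fun σ _ => Filter.Tendsto.const_smul
        (tendsto_finsetProd _ fun i _ => ?_) _
      exact (hadd _).div (continuousAt_const.mul hc.continuousAt) (mul_ne_zero (hxy _ _) ht)
    have hR : ContinuousAt (fun s => jacobiTheta₁ (∑ j, (x j - y j) + s) τ / jacobiTheta₁ s τ *
          (∏ i, ∏ j ∈ Finset.univ.filter (fun j => i < j),
            jacobiTheta₁ (x i - x j) τ * jacobiTheta₁ (y j - y i) τ) /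
          ∏ i, ∏ j, jacobiTheta₁ (x i - y j) τ) t :=
      (((hadd _).div hc.continuousAt ht).mul_const _).div_const _
    refine tendsto_nhds_unique_of_eventuallyEq (hL.tendsto.mono_left nhdsWithin_le_nhds)
      (hR.tendsto.mono_left nhdsWithin_le_nhds) (l := nhdsWithin t {t}ᶜ) ?_
    filter_upwards [eventually_jacobiTheta₁_add_ne_zero hτ ht t (x 0 - y 0),
      eventually_jacobiTheta₁_add_ne_zero hτ ht t 0] with s hs hs₀
    rw [zero_add] at hs₀
    exact frobenius_determinant_step hτ x y s hs₀ hs hxy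
      (ih (fun i => x i.succ) (fun j => y j.succ) _ hs fun i j => hxy _ _)
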